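/- arXiv:2501.14609 — 2 statements merged into one kernel-verified Lean document; each statement's English description precedes it below -/
import Mathlib

section
/- Let n ≥ 1 and let F_1, …, F_n : ℝ → ℝ → ℝ be cake valuations such that each F_i, viewed as a function of the pair (ℓ, r), is continuous on the set {(ℓ, r) : 0 ≤ ℓ ≤ r ≤ 1}, is normalized (F_i x x = 0 for all x ∈ [0,1]), and is nonnegative (F_i ℓ r ≥ 0 for all 0 ≤ ℓ ≤ r ≤ 1). Then there exist points 0 = e_0 ≤ e_1 ≤ … ≤ e_n = 1 such that F_i e_{i-1} e_i = F_j e_{j-1} e_j for all i, j ∈ {1, …, n}; that is, the ordered contiguous division assigning the i-th interval [e_{i-1}, e_i] from the left to agent i is equitable. -/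
/-- The labels `f k`, `k ∈ S`, include all of `0, …, m - 1`. -/
def LabelsCover (f : ℕ → ℕ) (S : Finset ℕ) (m : ℕ) : Prop :=
  ∀ c < m, ∃ k ∈ S, f k = c

theorem LabelsCover.injOn {f : ℕ → ℕ} {S : Finset ℕ} {m : ℕ} (h : LabelsCover f S m)
    (hS : S.card ≤ m) : Set.InjOn f S := by
  apply Finset.injOn_of_card_image_eq
  refine le_antisymm Finset.card_image_le (hS.trans ?_)
  have hsub : Finset.range m ⊆ S.image f := fun c hc => by
    obtain ⟨k, hk, rfl⟩ := h c (Finset.mem_range.1 hc)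
    exact Finset.mem_image_of_mem f hk
  simpa using Finset.card_le_card hsub

open Classical in
/-- In a simplex with labels at most `m`, the number of facets carrying all labels below `m`
has the parity of the indicator of the simplex carrying all labels up to `m`. -/
theorem card_covering_facets (f : ℕ → ℕ) (m : ℕ) (hf : ∀ k ≤ m, f k ≤ m) :
    ((((Finset.range (m + 1)).filter
      fun k => LabelsCover f ((Finset.range (m + 1)).erase k) m).card : ℕ) : ZMod 2) =
      if LabelsCover f (Finset.range (m + 1)) (m + 1) then 1 else 0 := by
  set A := (Finset.range (m + 1)).filter
      fun k => LabelsCover f ((Finset.range (m + 1)).erase k) m with hA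
  split_ifs with hfull
  · have hinj := hfull.injOn (by simp)
    obtain ⟨k₀, hk₀, hfk₀⟩ := hfull m (by omega)
    have : A = {k₀} := by
      ext k
      simp only [hA, Finset.mem_filter, Finset.mem_singleton]
      constructor
      · rintro ⟨hk, hc⟩
        by_contra hne
        have hkm : f k ≠ m := fun h => hne (hinj hk hk₀ (h.trans hfk₀.symm))
        have := hf k (by simpa [Nat.lt_succ_iff] using hk)
        obtain ⟨j, hj, hfj⟩ := hc (f k) (by omega)
        exact (Finset.mem_erase.1 hj).1 (hinj (Finset.mem_erase.1 hj).2 hk hfj)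
      · rintro rfl
        refine ⟨hk₀, fun c hc => ?_⟩
        obtain ⟨j, hj, hfj⟩ := hfull c (by omega)
        refine ⟨j, Finset.mem_erase.2 ⟨?_, hj⟩, hfj⟩
        rintro rfl
        omega
    simp [this]
  · rcases A.eq_empty_or_nonempty with h0 | ⟨k, hk⟩
    · simp [h0]
    obtain ⟨hkr, hc⟩ := Finset.mem_filter.1 hk
    have hinj := hc.injOn (by simp [Finset.card_erase_of_mem hkr])
    have hlt : ∀ j ∈ Finset.range (m + 1), f j < m := by
      intro j hj
      refine lt_of_le_of_ne (hf j (by simpa [Nat.lt_succ_iff] using hj)) fun hjm => hfull ?_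
      intro c hcm
      rcases Nat.lt_succ_iff_lt_or_eq.1 hcm with h | rfl
      · obtain ⟨i, hi, hfi⟩ := hc c h
        exact ⟨i, (Finset.mem_erase.1 hi).2, hfi⟩
      · exact ⟨j, hj, hjm⟩
    obtain ⟨k', hk', hfk'⟩ := hc (f k) (hlt k hkr)
    have hne := (Finset.mem_erase.1 hk').1
    have : A = {k, k'} := by
      ext j
      simp only [hA, Finset.mem_filter, Finset.mem_singleton, Finset.mem_insert]
      constructor
      · rintro ⟨hj, hcj⟩
        by_contra! hjk
        obtain ⟨i, hi, hfi⟩ := hcj (f j) (hlt j hj)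
        obtain ⟨hij, hi⟩ := Finset.mem_erase.1 hi
        have hj' := Finset.mem_erase.2 ⟨hjk.1, hj⟩
        by_cases hik : i = k
        · subst hik
          exact hjk.2 (hinj hj' hk' (by rw [hfk', hfi]))
        · exact hij (hinj (Finset.mem_erase.2 ⟨hik, hi⟩) hj' hfi)
      · rintro (rfl | rfl)
        · exact ⟨hkr, hc⟩
        · refine ⟨(Finset.mem_erase.1 hk').2, fun c hcm => ?_⟩
          obtain ⟨i, hi, hfi⟩ := hc c hcm
          by_cases hij : i = j
          · subst hij
            exact ⟨k, Finset.mem_erase.2 ⟨hne.symm, hkr⟩, by rw [← hfk', hfi]⟩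
          · exact ⟨i, Finset.mem_erase.2 ⟨hij, (Finset.mem_erase.1 hi).2⟩, hfi⟩
    rw [this, Finset.card_pair hne.symm]
    rfl

/-- The `k`-th vertex of the Freudenthal simplex with base point `p` and coordinate order `s`:
the coordinates of rank below `k` are increased by one. -/
def freudenthalVertex {D : ℕ} (p s : Fin D → ℕ) (k : ℕ) : Fin D → ℕ :=
  fun i => p i + if s i < k then 1 else 0

open Classical in
/-- The `d`-dimensional Freudenthal simplices of the grid `{0, …, N}^D` lying in the face where
all coordinates from `d` on vanish, encoded as pairs of a base point and a rank function. -/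
noncomputable def freudenthalCells (D N d : ℕ) : Finset ((Fin D → ℕ) × (Fin D → ℕ)) :=
  ((Fintype.piFinset fun _ => Finset.range N) ×ˢ
    (Fintype.piFinset fun _ => Finset.range D)).filter fun c =>
      Function.Injective c.2 ∧ ∀ i : Fin D,
        ((i : ℕ) < d → c.2 i < d) ∧ (d ≤ (i : ℕ) → c.2 i = i ∧ c.1 i = 0)

theorem mem_freudenthalCells {D N d : ℕ} {c : (Fin D → ℕ) × (Fin D → ℕ)} :
    c ∈ freudenthalCells D N d ↔ (∀ i, c.1 i < N) ∧ (∀ i, c.2 i < D) ∧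
      Function.Injective c.2 ∧ ∀ i : Fin D,
        ((i : ℕ) < d → c.2 i < d) ∧ (d ≤ (i : ℕ) → c.2 i = i ∧ c.1 i = 0) := by
  simp [freudenthalCells, Fintype.mem_piFinset, and_assoc]

theorem exists_rank_eq {D N d r : ℕ} {c : (Fin D → ℕ) × (Fin D → ℕ)}
    (hc : c ∈ freudenthalCells D N d) (hr : r < D) : ∃ j, c.2 j = r := by
  obtain ⟨-, h2, h3, -⟩ := mem_freudenthalCells.1 hc
  have hinj : Function.Injective fun i => (⟨c.2 i, h2 i⟩ : Fin D) :=
    fun i j h => h3 (by simpa using h)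
  obtain ⟨j, hj⟩ := Finite.surjective_of_injective hinj ⟨r, hr⟩
  exact ⟨j, by simpa using hj⟩

/-- The label conditions of the cubical Sperner lemma on the grid `{0, …, N}^D`. -/
structure IsCubicalLabelling {D : ℕ} (N : ℕ) (lab : (Fin D → ℕ) → ℕ) : Prop where
  le_dim : ∀ v, lab v ≤ D
  ne_succ_of_eq_zero : ∀ v (i : Fin D), v i = 0 → lab v ≠ i + 1
  ne_zero_of_eq_top : ∀ v (i : Fin D), v i = N → lab v ≠ 0

/-- The facet of the simplex `c` of dimension `d + 1` opposite to vertex `k` carries all labels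
up to `d`. -/
def IsDoor {D : ℕ} (lab : (Fin D → ℕ) → ℕ) (d k : ℕ) (c : (Fin D → ℕ) × (Fin D → ℕ)) : Prop :=
  LabelsCover (fun j => lab (freudenthalVertex c.1 c.2 j)) ((Finset.range (d + 2)).erase k) (d + 1)

/-- The simplex `c` of dimension `d` carries all labels up to `d`. -/
def IsFullyLabelled {D : ℕ} (lab : (Fin D → ℕ) → ℕ) (d : ℕ)
    (c : (Fin D → ℕ) × (Fin D → ℕ)) : Prop :=
  LabelsCover (fun j => lab (freudenthalVertex c.1 c.2 j)) (Finset.range (d + 1)) (d + 1)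

open Classical in
/-- Facets opposite to an intermediate vertex are shared by two simplices. -/
theorem card_door_intermediate {D N d k : ℕ} (lab : (Fin D → ℕ) → ℕ) (hd : d < D) (hk : 0 < k)
    (hkd : k ≤ d) :
    ((((freudenthalCells D N (d + 1)).filter (IsDoor lab d k)).card : ℕ) : ZMod 2) = 0 := by
  rw [Finset.card_eq_sum_ones, Nat.cast_sum]
  refine Finset.sum_involution (fun c _ => (c.1, fun i => Equiv.swap (k - 1) k (c.2 i)))
    ?_ ?_ ?_ ?_
  · intros; rfl
  · intro c hc _ heq
    obtain ⟨j, hj⟩ := exists_rank_eq (Finset.mem_filter.1 hc).1 (show k < D by omega)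
    have := congrFun (congrArg Prod.snd heq) j
    simp only [hj, Equiv.swap_apply_right] at this
    omega
  · intro c hc
    obtain ⟨hc, hdoor⟩ := Finset.mem_filter.1 hc
    obtain ⟨h1, h2, h3, h4⟩ := mem_freudenthalCells.1 hc
    refine Finset.mem_filter.2 ⟨mem_freudenthalCells.2 ⟨h1, ?_, ?_, ?_⟩, ?_⟩
    · intro i
      have := h2 i
      simp only [Equiv.swap_apply_def]
      split_ifs <;> omega
    · exact (Equiv.injective _).comp h3
    · intro i
      have := h4 i
      simp only [Equiv.swap_apply_def]
      refine ⟨fun hi => ?_, fun hi => ?_⟩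
      · have := this.1 hi
        split_ifs <;> omega
      · have := this.2 hi
        split_ifs <;> omega
    · intro l hl
      obtain ⟨j, hj, hjl⟩ := hdoor l hl
      refine ⟨j, hj, ?_⟩
      rw [← hjl]
      have hjk := (Finset.mem_erase.1 hj).1
      simp only
      congr 1
      ext i
      simp only [freudenthalVertex, Equiv.swap_apply_def]
      split_ifs <;> omega
  · intro c _
    simp

theorem freudenthalCells_subset_succ (D N d : ℕ) :
    freudenthalCells D N d ⊆ freudenthalCells D N (d + 1) := by
  intro c hc
  obtain ⟨h1, h2, h3, h4⟩ := mem_freudenthalCells.1 hc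
  refine mem_freudenthalCells.2 ⟨h1, h2, h3, fun i => ⟨fun hi => ?_, fun hi => ?_⟩⟩
  · rcases Nat.lt_succ_iff_lt_or_eq.1 hi with h | h
    · exact ((h4 i).1 h).trans (Nat.lt_succ_self d)
    · have := ((h4 i).2 h.ge).1
      omega
  · exact (h4 i).2 (by omega)

theorem range_erase_last (d : ℕ) :
    (Finset.range (d + 2)).erase (d + 1) = Finset.range (d + 1) := by
  ext
  simp only [Finset.mem_erase, Finset.mem_range]
  omega

/-- A door opposite to the last vertex that lies on the boundary of the grid lies on the face
where the last coordinate vanishes. -/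
theorem mem_freudenthalCells_of_door_last {D N d : ℕ} {lab : (Fin D → ℕ) → ℕ}
    (hlab : IsCubicalLabelling N lab) {c : (Fin D → ℕ) × (Fin D → ℕ)}
    (hc : c ∈ freudenthalCells D N (d + 1)) (hdoor : IsDoor lab d (d + 1) c) {i : Fin D}
    (hi : c.2 i = d) (hpi : c.1 i = 0) : c ∈ freudenthalCells D N d := by
  obtain ⟨h1, h2, h3, h4⟩ := mem_freudenthalCells.1 hc
  have hid : (i : ℕ) = d := by
    by_contra hne
    have hlt : (i : ℕ) < d := by
      by_contra hge
      have := ((h4 i).2 (by omega)).1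
      omega
    obtain ⟨k, hk, hkl⟩ := hdoor (i + 1) (by omega)
    refine hlab.ne_succ_of_eq_zero _ i ?_ hkl
    rw [range_erase_last, Finset.mem_range] at hk
    simp only [freudenthalVertex, hpi, hi]
    rw [if_neg (by omega)]
  refine mem_freudenthalCells.2 ⟨h1, h2, h3, fun j => ⟨fun hj => ?_, fun hj => ?_⟩⟩
  · have := (h4 j).1 (by omega)
    have hne : c.2 j ≠ d := fun h => by
      have := h3 (h.trans hi.symm)
      subst this
      omega
    omega
  · rcases hj.eq_or_lt with h | h
    · obtain rfl : j = i := Fin.ext (by omega)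
      exact ⟨by omega, hpi⟩
    · exact (h4 j).2 (by omega)

/-- No door opposite to the initial vertex lies on the boundary of the grid. -/
theorem succ_lt_of_door_zero {D N d : ℕ} {lab : (Fin D → ℕ) → ℕ}
    (hlab : IsCubicalLabelling N lab) {c : (Fin D → ℕ) × (Fin D → ℕ)}
    (hc : c ∈ freudenthalCells D N (d + 1)) (hdoor : IsDoor lab d 0 c) {i : Fin D}
    (hi : c.2 i = 0) : c.1 i + 1 < N := by
  have h1 := (mem_freudenthalCells.1 hc).1 i
  refine lt_of_le_of_ne h1 fun heq => ?_
  obtain ⟨k, hk, hkl⟩ := hdoor 0 (by omega)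
  refine hlab.ne_zero_of_eq_top _ i ?_ hkl
  have := (Finset.mem_erase.1 hk).1
  simp only [freudenthalVertex, hi]
  rw [if_pos (by omega), heq]

open Classical in
/-- Facets opposite to the last vertex are matched with those opposite to the initial vertex of
a neighbouring simplex, except on the face where the last coordinate vanishes. -/
theorem card_door_last {D N d : ℕ} {lab : (Fin D → ℕ) → ℕ} (hlab : IsCubicalLabelling N lab)
    (hd : d < D) :
    ((freudenthalCells D N (d + 1)).filter (IsDoor lab d (d + 1))).card =
      ((freudenthalCells D N (d + 1)).filter (IsDoor lab d 0)).card +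
      ((freudenthalCells D N d).filter (IsFullyLabelled lab d)).card := by
  rw [← Finset.card_filter_add_card_filter_not
    (s := (freudenthalCells D N (d + 1)).filter (IsDoor lab d (d + 1)))
    (fun c => c ∉ freudenthalCells D N d)]
  have hpos : ∀ c ∈ ((freudenthalCells D N (d + 1)).filter (IsDoor lab d (d + 1))).filter
      (fun c => c ∉ freudenthalCells D N d), ∀ i, c.2 i = d → 0 < c.1 i := by
    intro c hc i hi
    obtain ⟨hc, hnot⟩ := Finset.mem_filter.1 hc
    obtain ⟨hc, hdoor⟩ := Finset.mem_filter.1 hc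
    exact Nat.pos_of_ne_zero fun h0 =>
      hnot (mem_freudenthalCells_of_door_last hlab hc hdoor hi h0)
  congr 1
  · refine Finset.card_nbij'
      (fun c => (fun i => if c.2 i = d then c.1 i - 1 else c.1 i,
        fun i => if c.2 i = d then 0 else if c.2 i < d then c.2 i + 1 else c.2 i))
      (fun c => (fun i => if c.2 i = 0 then c.1 i + 1 else c.1 i,
        fun i => if c.2 i = 0 then d else if c.2 i ≤ d then c.2 i - 1 else c.2 i)) ?_ ?_ ?_ ?_
    · intro c hc
      have hp := hpos c hc
      obtain ⟨hc, -⟩ := Finset.mem_filter.1 hc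
      obtain ⟨hc, hdoor⟩ := Finset.mem_filter.1 hc
      obtain ⟨h1, h2, h3, h4⟩ := mem_freudenthalCells.1 hc
      refine Finset.mem_filter.2 ⟨mem_freudenthalCells.2 ⟨?_, ?_, ?_, ?_⟩, ?_⟩
      · intro i
        have := h1 i
        dsimp only
        split_ifs <;> omega
      · intro i
        have := h2 i
        dsimp only
        split_ifs <;> omega
      · intro i j hij
        apply h3
        dsimp only at hij
        split_ifs at hij <;> omega
      · intro i
        have := h4 i
        dsimp only
        refine ⟨fun hi => ?_, fun hi => ?_⟩
        · have := this.1 hi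
          split_ifs <;> omega
        · have := this.2 hi
          split_ifs <;> omega
      · intro l hl
        obtain ⟨j, hj, hjl⟩ := hdoor l hl
        rw [range_erase_last, Finset.mem_range] at hj
        refine ⟨j + 1, Finset.mem_erase.2 ⟨by omega, Finset.mem_range.2 (by omega)⟩, ?_⟩
        rw [← hjl]
        dsimp only
        congr 1
        ext i
        have := hp i
        simp only [freudenthalVertex]
        split_ifs <;> omega
    · intro c hc
      obtain ⟨hc, hdoor⟩ := Finset.mem_filter.1 hc
      have hp := fun i => succ_lt_of_door_zero hlab hc hdoor (i := i)
      obtain ⟨j₀, hj₀⟩ := exists_rank_eq hc (show 0 < D by omega)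
      obtain ⟨h1, h2, h3, h4⟩ := mem_freudenthalCells.1 hc
      refine Finset.mem_filter.2 ⟨Finset.mem_filter.2
        ⟨mem_freudenthalCells.2 ⟨?_, ?_, ?_, ?_⟩, ?_⟩, ?_⟩
      · intro i
        have := h1 i
        have := hp i
        dsimp only
        split_ifs <;> omega
      · intro i
        have := h2 i
        dsimp only
        split_ifs <;> omega
      · intro i j hij
        apply h3
        dsimp only at hij
        split_ifs at hij <;> omega
      · intro i
        have := h4 i
        dsimp only
        refine ⟨fun hi => ?_, fun hi => ?_⟩
        · have := this.1 hi
          split_ifs <;> omega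
        · have := this.2 hi
          split_ifs <;> omega
      · intro l hl
        obtain ⟨j, hj, hjl⟩ := hdoor l hl
        obtain ⟨hj0, hjr⟩ := Finset.mem_erase.1 hj
        rw [Finset.mem_range] at hjr
        refine ⟨j - 1, by rw [range_erase_last, Finset.mem_range]; omega, ?_⟩
        rw [← hjl]
        dsimp only
        congr 1
        ext i
        simp only [freudenthalVertex]
        split_ifs <;> omega
      · intro hmem
        have h := (mem_freudenthalCells.1 hmem).2.2.2 j₀
        simp only [hj₀, if_true] at h
        rcases lt_or_ge (j₀ : ℕ) d with hlt | hge
        · exact (h.1 hlt).false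
        · have := (h.2 hge).2
          omega
    · intro c hc
      have hp := hpos c hc
      ext i
      · have := hp i
        grind
      · grind
    · intro c hc
      ext i
      · dsimp only
        split_ifs <;> omega
      · dsimp only
        split_ifs <;> omega
  · congr 1
    ext c
    simp only [Finset.mem_filter, not_not, IsDoor, IsFullyLabelled, range_erase_last]
    exact ⟨fun h => ⟨h.2, h.1.2⟩, fun h => ⟨⟨freudenthalCells_subset_succ D N d h.1, h.2⟩, h.1⟩⟩

open Classical in
/-- The parity of the number of fully labelled simplices does not depend on the dimension. -/
theorem card_fullyLabelled_succ {D N d : ℕ} {lab : (Fin D → ℕ) → ℕ}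
    (hlab : IsCubicalLabelling N lab) (hd : d < D) :
    ((((freudenthalCells D N (d + 1)).filter (IsFullyLabelled lab (d + 1))).card : ℕ) : ZMod 2) =
      ((((freudenthalCells D N d).filter (IsFullyLabelled lab d)).card : ℕ) : ZMod 2) := by
  have hcell : ∀ c ∈ freudenthalCells D N (d + 1),
      (if IsFullyLabelled lab (d + 1) c then (1 : ZMod 2) else 0) =
        ∑ k ∈ Finset.range (d + 2), if IsDoor lab d k c then (1 : ZMod 2) else 0 := by
    intro c hc
    rw [Finset.sum_boole]
    refine (card_covering_facets _ (d + 1) fun k hk => ?_).symm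
    by_contra! hgt
    set v := freudenthalVertex c.1 c.2 k with hv
    have hle := hlab.le_dim v
    have h := ((mem_freudenthalCells.1 hc).2.2.2 ⟨lab v - 1, by omega⟩).2
      (show d + 1 ≤ lab v - 1 by omega)
    refine hlab.ne_succ_of_eq_zero v ⟨lab v - 1, by omega⟩ ?_ (show lab v = lab v - 1 + 1 by omega)
    change c.1 _ + (if c.2 _ < k then 1 else 0) = 0
    rw [h.2, h.1, if_neg (show ¬ lab v - 1 < k by omega)]
  rw [← Finset.sum_boole, Finset.sum_congr rfl hcell, Finset.sum_comm, Finset.sum_range_succ,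
    Finset.sum_range_succ']
  simp only [Finset.sum_boole]
  rw [Finset.sum_eq_zero fun k hk => card_door_intermediate lab hd (Nat.succ_pos k)
    (Finset.mem_range.1 hk), card_door_last hlab hd]
  push_cast
  rw [zero_add, ← add_assoc, CharTwo.add_self_eq_zero, zero_add]

/-- **Cubical Sperner lemma.** -/
theorem exists_fullyLabelled {D N : ℕ} (hN : 0 < N) {lab : (Fin D → ℕ) → ℕ}
    (hlab : IsCubicalLabelling N lab) :
    ∃ c ∈ freudenthalCells D N D, IsFullyLabelled lab D c := by
  classical
  have hone : ∀ d ≤ D, ((((freudenthalCells D N d).filter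
      (IsFullyLabelled lab d)).card : ℕ) : ZMod 2) = 1 := by
    intro d hd
    induction d with
    | succ d ih => rw [card_fullyLabelled_succ hlab hd, ih (by omega)]
    | zero =>
      have : (freudenthalCells D N 0).filter (IsFullyLabelled lab 0) =
          {((fun _ : Fin D => 0), fun i : Fin D => (i : ℕ))} := by
        ext c
        rw [Finset.mem_filter, mem_freudenthalCells, Finset.mem_singleton]
        constructor
        · rintro ⟨⟨-, -, -, h⟩, -⟩
          ext i
          · exact ((h i).2 (Nat.zero_le _)).2
          · exact ((h i).2 (Nat.zero_le _)).1
        · rintro rfl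
          refine ⟨⟨fun _ => hN, fun i => i.2, Fin.val_injective, fun i => by simp⟩, ?_⟩
          intro l hl
          refine ⟨0, by simp, ?_⟩
          obtain rfl : l = 0 := by omega
          by_contra hne
          set v := freudenthalVertex (fun _ : Fin D => 0) (fun i => (i : ℕ)) 0 with hv
          have hle := hlab.le_dim v
          refine hlab.ne_succ_of_eq_zero v ⟨lab v - 1, ?_⟩ ?_ ?_
          · change lab v ≠ 0 at hne
            omega
          · simp [hv, freudenthalVertex]
          · change lab v ≠ 0 at hne
            change lab v = lab v - 1 + 1
            omega
      simp [this]
  obtain ⟨c, hc⟩ : ((freudenthalCells D N D).filter (IsFullyLabelled lab D)).Nonempty := by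
    rw [Finset.nonempty_iff_ne_empty]
    intro h
    simpa [h] using hone D le_rfl
  exact ⟨c, (Finset.mem_filter.1 hc).1, (Finset.mem_filter.1 hc).2⟩

/-- Discrete form of the Poincaré–Miranda theorem on the grid of mesh `1 / N`. -/
theorem exists_approx_zero {D N : ℕ} (hN : 0 < N) (g : Fin D → (Fin D → ℝ) → ℝ)
    (h0 : ∀ i, ∀ x ∈ Set.Icc (0 : Fin D → ℝ) 1, x i = 0 → g i x ≤ 0)
    (h1 : ∀ i, ∀ x ∈ Set.Icc (0 : Fin D → ℝ) 1, x i = 1 → 0 ≤ g i x) :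
    ∃ x ∈ Set.Icc (0 : Fin D → ℝ) 1,
      (∀ i, ∃ y ∈ Set.Icc (0 : Fin D → ℝ) 1, dist y x ≤ 1 / N ∧ 0 ≤ g i y) ∧
      ∃ y ∈ Set.Icc (0 : Fin D → ℝ) 1, dist y x ≤ 1 / N ∧ ∀ i, g i y ≤ 0 := by
  classical
  have hN' : (0 : ℝ) < N := Nat.cast_pos.2 hN
  let scale : (Fin D → ℕ) → Fin D → ℝ := fun v i => v i / N
  let good : (Fin D → ℕ) → Fin D → Prop := fun v i => v i ≠ 0 ∧ (v i = N ∨ 0 ≤ g i (scale v))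
  let lab : (Fin D → ℕ) → ℕ := fun v => if h : ∃ i, good v i then h.choose + 1 else 0
  have hlab_succ : ∀ v (i : Fin D), lab v = i + 1 → good v i := by
    intro v i h
    by_cases hex : ∃ i, good v i
    · simp only [lab, dif_pos hex] at h
      have : hex.choose = i := Fin.ext (by omega)
      exact this ▸ hex.choose_spec
    · simp [lab, dif_neg hex] at h
  have hlab_zero : ∀ v, lab v = 0 → ∀ i, ¬ good v i := by
    intro v h i hi
    simp [lab, dif_pos (⟨i, hi⟩ : ∃ i, good v i)] at h
  have hlab : IsCubicalLabelling N lab := by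
    refine ⟨fun v => ?_, fun v i hi h => (hlab_succ v i h).1 hi,
      fun v i hi h => hlab_zero v h i ⟨by omega, Or.inl hi⟩⟩
    by_cases hex : ∃ i, good v i
    · simp only [lab, dif_pos hex]
      exact hex.choose.2
    · simp [lab, dif_neg hex]
  obtain ⟨⟨p, s⟩, hc, hfull⟩ := exists_fullyLabelled hN hlab
  have hp := (mem_freudenthalCells.1 hc).1
  have hcube : ∀ v : Fin D → ℕ, (∀ i, v i ≤ N) → scale v ∈ Set.Icc (0 : Fin D → ℝ) 1 := by
    intro v hv
    refine ⟨fun i => by simp only [scale, Pi.zero_apply]; positivity, fun i => ?_⟩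
    simp only [scale, Pi.one_apply]
    rw [div_le_one hN']
    exact_mod_cast hv i
  have hvle : ∀ k i, freudenthalVertex p s k i ≤ N := by
    intro k i
    have := hp i
    simp only [freudenthalVertex]
    simp only at this
    split_ifs <;> omega
  have hdist : ∀ k, dist (scale (freudenthalVertex p s k)) (scale p) ≤ 1 / N := by
    intro k
    refine (dist_pi_le_iff (by positivity)).2 fun i => ?_
    simp only [scale, freudenthalVertex, Real.dist_eq]
    rw [← sub_div, abs_div, abs_of_pos hN']
    gcongr
    split_ifs <;> simp
  refine ⟨scale p, hcube p fun i => (hp i).le, fun i => ?_, ?_⟩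
  · obtain ⟨k, -, hk⟩ := hfull (i + 1) (by omega)
    have hmem := hcube _ (hvle k)
    refine ⟨_, hmem, hdist k, ?_⟩
    rcases (hlab_succ _ i hk).2 with h | h
    · refine h1 i _ hmem ?_
      change ((freudenthalVertex p s k i : ℕ) : ℝ) / N = 1
      simp only at h
      rw [h, div_self hN'.ne']
    · exact h
  · obtain ⟨k, -, hk⟩ := hfull 0 (by omega)
    have hmem := hcube _ (hvle k)
    refine ⟨_, hmem, hdist k, fun i => ?_⟩
    have hnot := hlab_zero _ hk i
    by_cases hz : freudenthalVertex p s k i = 0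
    · refine h0 i _ hmem ?_
      change ((freudenthalVertex p s k i : ℕ) : ℝ) / N = 0
      rw [hz, Nat.cast_zero, zero_div]
    · by_contra! hgt
      exact hnot ⟨hz, Or.inr hgt.le⟩

/-- **Poincaré–Miranda theorem** on the unit cube. -/
theorem exists_zero_of_poincare_miranda {D : ℕ} (g : Fin D → (Fin D → ℝ) → ℝ)
    (hg : ∀ i, ContinuousOn (g i) (Set.Icc 0 1))
    (h0 : ∀ i, ∀ x ∈ Set.Icc (0 : Fin D → ℝ) 1, x i = 0 → g i x ≤ 0)
    (h1 : ∀ i, ∀ x ∈ Set.Icc (0 : Fin D → ℝ) 1, x i = 1 → 0 ≤ g i x) :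
    ∃ x ∈ Set.Icc (0 : Fin D → ℝ) 1, ∀ i, g i x = 0 := by
  choose x hx hpos hneg using fun m : ℕ => exists_approx_zero (Nat.succ_pos m) g h0 h1
  choose y hy hyx hgy using hpos
  choose z hz hzx hgz using hneg
  obtain ⟨a, ha, φ, hφ, hlim⟩ := isCompact_Icc.tendsto_subseq hx
  have hmesh : Filter.Tendsto (fun m => 1 / ((φ m).succ : ℝ)) Filter.atTop (nhds 0) := by
    simpa [Function.comp_def] using (tendsto_one_div_add_atTop_nhds_zero_nat (𝕜 := ℝ)).comp hφ.tendsto_atTop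
  have hnear : ∀ w : ℕ → Fin D → ℝ, (∀ m, w m ∈ Set.Icc (0 : Fin D → ℝ) 1) →
      (∀ m, dist (w m) (x m) ≤ 1 / (m.succ : ℝ)) →
      Filter.Tendsto (fun m => w (φ m)) Filter.atTop (nhdsWithin a (Set.Icc 0 1)) := by
    intro w hw hwx
    refine tendsto_nhdsWithin_iff.2 ⟨?_, Filter.Eventually.of_forall fun m => hw _⟩
    refine (tendsto_iff_of_dist ?_).2 hlim
    exact squeeze_zero (fun _ => dist_nonneg) (fun m => hwx (φ m)) hmesh
  refine ⟨a, ha, fun i => le_antisymm ?_ ?_⟩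
  · exact le_of_tendsto' ((hg i a ha).tendsto.comp (hnear z hz hzx)) fun m => hgz (φ m) i
  · exact ge_of_tendsto' ((hg i a ha).tendsto.comp
      (hnear (fun m => y m i) (fun m => hy m i) fun m => hyx m i)) fun m => hgy (φ m) i

/-- Cut points obtained by successively splitting off the rightmost piece:
the cut point of index `k + 1` is the product of the ratios `y j` with `j ≥ k`. -/
noncomputable def stickBreakingCut {D : ℕ} (y : Fin D → ℝ) : ℕ → ℝ
  | 0 => 0
  | k + 1 => ∏ j : Fin D, if k ≤ (j : ℕ) then y j else 1

theorem stickBreakingCut_succ {D : ℕ} (y : Fin D → ℝ) (i : Fin D) :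
    stickBreakingCut y (i + 1) = y i * stickBreakingCut y (i + 2) := by
  simp only [stickBreakingCut]
  rw [← Finset.mul_prod_erase _ _ (Finset.mem_univ i),
    ← Finset.mul_prod_erase (a := i) _ (fun j : Fin D => if (i : ℕ) + 1 ≤ (j : ℕ) then y j else 1)
      (Finset.mem_univ i)]
  simp only [le_refl, if_true, Nat.not_succ_le_self, if_false, one_mul]
  congr 1
  refine Finset.prod_congr rfl fun j hj => ?_
  have : (j : ℕ) ≠ i := fun h => (Finset.mem_erase.1 hj).1 (Fin.ext h)
  split_ifs <;> first | rfl | omega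

theorem stickBreakingCut_last {D : ℕ} (y : Fin D → ℝ) : stickBreakingCut y (D + 1) = 1 := by
  simp only [stickBreakingCut]
  exact Finset.prod_eq_one fun j _ => if_neg (by omega)

theorem continuous_stickBreakingCut {D : ℕ} (k : ℕ) :
    Continuous fun y : Fin D → ℝ => stickBreakingCut y k := by
  cases k with
  | zero => exact continuous_const
  | succ k =>
    refine continuous_finsetProd _ fun j _ => ?_
    split_ifs <;> fun_prop

theorem stickBreakingCut_mem_Icc {D : ℕ} {y : Fin D → ℝ} (hy : y ∈ Set.Icc (0 : Fin D → ℝ) 1)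
    (k : ℕ) : stickBreakingCut y k ∈ Set.Icc (0 : ℝ) 1 := by
  cases k with
  | zero => simp [stickBreakingCut]
  | succ k =>
    refine ⟨Finset.prod_nonneg fun j _ => ?_, Finset.prod_le_one (fun j _ => ?_) fun j _ => ?_⟩
    · split_ifs
      exacts [hy.1 j, zero_le_one]
    · split_ifs
      exacts [hy.1 j, zero_le_one]
    · split_ifs
      exacts [hy.2 j, le_rfl]

theorem stickBreakingCut_le_succ {D : ℕ} {y : Fin D → ℝ} (hy : y ∈ Set.Icc (0 : Fin D → ℝ) 1)
    {k : ℕ} (hk : k < D + 1) : stickBreakingCut y k ≤ stickBreakingCut y (k + 1) := by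
  cases k with
  | zero => exact (stickBreakingCut_mem_Icc hy 1).1
  | succ k =>
    have h := stickBreakingCut_succ y ⟨k, by omega⟩
    simp only at h
    rw [h]
    exact mul_le_of_le_one_left (stickBreakingCut_mem_Icc hy _).1 (hy.2 _)

/-- **Existence of ordered equitable contiguous cake divisions under
nonnegative valuations.** Each agent `i : Fin n` has a cake valuation
`F i`, where `F i ℓ r` is the value of the interval `[ℓ, r] ⊆ [0,1]`.
If every valuation is continuous (as a function of the endpoint pair),
normalized and nonnegative, then there are cut points
`0 = e 0 ≤ e 1 ≤ ⋯ ≤ e n = 1` such that the ordered division assigning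
the `i`-th interval from the left to agent `i` is equitable. -/
theorem stmt_0 (n : ℕ) (hn : 1 ≤ n) (F : Fin n → ℝ → ℝ → ℝ)
    (hcont : ∀ i, ContinuousOn (fun p : ℝ × ℝ => F i p.1 p.2)
      {p : ℝ × ℝ | 0 ≤ p.1 ∧ p.1 ≤ p.2 ∧ p.2 ≤ 1})
    (hnorm : ∀ i, ∀ x ∈ Set.Icc (0 : ℝ) 1, F i x x = 0)
    (hnonneg : ∀ i, ∀ ℓ r : ℝ, 0 ≤ ℓ → ℓ ≤ r → r ≤ 1 → 0 ≤ F i ℓ r) :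
    ∃ e : ℕ → ℝ, e 0 = 0 ∧ e n = 1 ∧ (∀ i < n, e i ≤ e (i + 1)) ∧
      ∀ i j : Fin n, F i (e i.val) (e (i.val + 1)) = F j (e j.val) (e (j.val + 1)) := by
  obtain ⟨D, rfl⟩ : ∃ D, n = D + 1 := ⟨n - 1, by omega⟩
  let value : Fin (D + 1) → (Fin D → ℝ) → ℝ := fun i y =>
    F i (stickBreakingCut y i) (stickBreakingCut y (i + 1))
  have hvalue_nonneg : ∀ i, ∀ y ∈ Set.Icc (0 : Fin D → ℝ) 1, 0 ≤ value i y := fun i y hy =>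
    hnonneg i _ _ (stickBreakingCut_mem_Icc hy _).1 (stickBreakingCut_le_succ hy i.2)
      (stickBreakingCut_mem_Icc hy _).2
  have hvalue_zero : ∀ i : Fin (D + 1), ∀ y ∈ Set.Icc (0 : Fin D → ℝ) 1,
      stickBreakingCut y i = stickBreakingCut y (i + 1) → value i y = 0 := fun i y hy h => by
    simp only [value]
    rw [← h]
    exact hnorm i _ (stickBreakingCut_mem_Icc hy _)
  have hvalue_cont : ∀ i, ContinuousOn (value i) (Set.Icc 0 1) := fun i =>
    (hcont i).comp
      (f := fun y : Fin D → ℝ => (stickBreakingCut y i, stickBreakingCut y (i + 1)))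
      ((continuous_stickBreakingCut _).prodMk (continuous_stickBreakingCut _)).continuousOn
      fun y hy => ⟨(stickBreakingCut_mem_Icc hy _).1, stickBreakingCut_le_succ hy i.2,
        (stickBreakingCut_mem_Icc hy (i + 1)).2⟩
  obtain ⟨y, hy, hzero⟩ := exists_zero_of_poincare_miranda
    (fun i y => value i.castSucc y - value i.succ y)
    (fun i => (hvalue_cont _).sub (hvalue_cont _))
    (fun i y hy hi => by
      have hcut : stickBreakingCut y (i + 1) = 0 := by
        rw [stickBreakingCut_succ, hi, zero_mul]
      have hcut' : stickBreakingCut y i = 0 :=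
        le_antisymm (hcut ▸ stickBreakingCut_le_succ hy (by omega))
          (stickBreakingCut_mem_Icc hy _).1
      have := hvalue_zero i.castSucc y hy (hcut'.trans hcut.symm)
      have := hvalue_nonneg i.succ y hy
      linarith)
    (fun i y hy hi => by
      have hcut : stickBreakingCut y (i + 1) = stickBreakingCut y (i + 2) := by
        rw [stickBreakingCut_succ, hi, one_mul]
      have := hvalue_zero i.succ y hy (by simpa using hcut)
      have := hvalue_nonneg i.castSucc y hy
      linarith)
  have hconst : ∀ i, value i y = value 0 y := fun i => by
    induction i using Fin.induction with
    | zero => rfl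
    | succ i ih => rw [← ih, sub_eq_zero.1 (hzero i)]
  exact ⟨stickBreakingCut y, rfl, stickBreakingCut_last y,
    fun i hi => stickBreakingCut_le_succ hy hi, fun i j => (hconst i).trans (hconst j).symm⟩
end

section
/- Let n ≥ 1, let γ > 0, and let F_1, …, F_n : ℝ → ℝ → ℝ be cake valuations that are normalized (F_i x x = 0 for all x ∈ [0,1]), nonnegative (F_i ℓ r ≥ 0 for all 0 ≤ ℓ ≤ r ≤ 1), and γ-Lipschitz. Let ε ∈ (0, 1/(4γ)) and set δ = ε/(8γ) and G = {kδ : k ∈ ℕ, kδ ≤ 1} ∪ {1}. Then there exist points 0 = e_0 ≤ e_1 ≤ … ≤ e_n = 1 with e_i ∈ G for every i, such that |F_i e_{i-1} e_i − F_j e_{j-1} e_j| ≤ ε for all i, j ∈ {1, …, n}. -/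
/-- The grid of granularity `δ` inside `[0,1]`: all multiples `k·δ ≤ 1`
together with the point `1`. -/
def grid (δ : ℝ) : Set ℝ :=
  {x : ℝ | ∃ k : ℕ, x = (k : ℝ) * δ ∧ (k : ℝ) * δ ≤ 1} ∪ {1}

section CubicalCup

variable {ι : Type*} [DecidableEq ι]

/-- The mod-two cubical cup product of the coboundaries of the functions `f a`, `a ∈ l`, evaluated
on the unit cube with base point `x` and edge directions `S`. -/
def cubeCup (f : ι → (ι → ℕ) → ZMod 2) : List ι → Finset ι → (ι → ℕ) → ZMod 2
  | [], _, _ => 1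
  | a :: l, S, x => ∑ i ∈ S, (f a (x + Pi.single i 1) + f a x) *
      cubeCup f l (S.erase i) (x + Pi.single i 1)

theorem sum_sum_erase_comm {M : Type*} [AddCommMonoid M] (S : Finset ι) (g : ι → ι → M) :
    ∑ i ∈ S, ∑ j ∈ S.erase i, g i j = ∑ i ∈ S, ∑ j ∈ S.erase i, g j i :=
  Finset.sum_comm' (by intro i j; simp only [Finset.mem_erase]; tauto)

theorem sum_sum_erase_eq_zero_of_symm (S : Finset ι) (g : ι → ι → ZMod 2)
    (hg : ∀ i j, g i j = g j i) : ∑ i ∈ S, ∑ j ∈ S.erase i, g i j = 0 := by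
  rw [Finset.sum_sigma']
  refine Finset.sum_involution (fun p _ => ⟨p.2, p.1⟩) ?_ ?_ ?_ ?_
  · rintro ⟨i, j⟩ _
    rw [hg i j]
    exact CharTwo.add_self_eq_zero _
  · rintro ⟨i, j⟩ h _ h'
    simp only [Finset.mem_sigma, Finset.mem_erase] at h
    simp only [Sigma.mk.injEq, heq_eq_eq] at h'
    exact h.2.1 h'.1
  · rintro ⟨i, j⟩ h
    simp only [Finset.mem_sigma, Finset.mem_erase] at h ⊢
    exact ⟨h.2.2, h.2.1.symm, h.1⟩
  · rintro ⟨i, j⟩ _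
    rfl

/-- The cup product of coboundaries is a cocycle. -/
theorem cubeCup_closed (f : ι → (ι → ℕ) → ZMod 2) (l : List ι) (S : Finset ι) (x : ι → ℕ) :
    ∑ i ∈ S, cubeCup f l (S.erase i) (x + Pi.single i 1) =
      ∑ i ∈ S, cubeCup f l (S.erase i) x := by
  induction l generalizing S x with
  | nil => rfl
  | cons a l ih =>
    have hP : ∀ i j, cubeCup f l ((S.erase i).erase j) = cubeCup f l ((S.erase j).erase i) :=
      fun i j => by rw [Finset.erase_right_comm]
    simp only [cubeCup, add_mul, Finset.sum_add_distrib]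
    rw [sum_sum_erase_eq_zero_of_symm S (fun i j =>
      f a (x + (Pi.single i 1 : ι → ℕ) + (Pi.single j 1 : ι → ℕ)) *
        cubeCup f l ((S.erase i).erase j) (x + (Pi.single i 1 : ι → ℕ) + (Pi.single j 1 : ι → ℕ)))
      (fun i j => by rw [hP i j, add_right_comm]), zero_add]
    have hconst : ∑ i ∈ S, ∑ j ∈ S.erase i,
        f a x * cubeCup f l ((S.erase i).erase j) (x + Pi.single j 1) = 0 := by
      simp only [← Finset.mul_sum, ih]
      rw [sum_sum_erase_eq_zero_of_symm S (fun i j => cubeCup f l ((S.erase i).erase j) x)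
        (fun i j => by rw [hP i j]), mul_zero]
    rw [hconst, add_zero]
    simp only [← Finset.mul_sum, ih]
    simp only [Finset.mul_sum]
    rw [sum_sum_erase_comm]
    simp only [hP]

/-- The cup product vanishes on a cube on which one of the factors is constant. -/
theorem cubeCup_eq_zero (f : ι → (ι → ℕ) → ZMod 2) {i : ι} {c : ℕ} {b : ZMod 2}
    (hf : ∀ y : ι → ℕ, y i = c → f i y = b) (l : List ι) (hl : i ∈ l) (S : Finset ι) (hS : i ∉ S)
    (x : ι → ℕ) (hx : x i = c) : cubeCup f l S x = 0 := by
  induction l generalizing S x with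
  | nil => simp at hl
  | cons a l ih =>
    refine Finset.sum_eq_zero fun j hj => ?_
    have hij : i ≠ j := fun h => hS (h ▸ hj)
    have hx' : (x + Pi.single j 1 : ι → ℕ) i = c := by simp [hx, hij]
    rcases List.mem_cons.1 hl with rfl | hl
    · rw [hf _ hx', hf _ hx, CharTwo.add_self_eq_zero, zero_mul]
    · rw [ih hl _ (fun h => hS (Finset.mem_of_mem_erase h)) _ hx', mul_zero]

/-- A cube with nonzero cup product has, for each factor, two vertices which it separates. -/
theorem exists_ne_of_cubeCup_ne_zero (f : ι → (ι → ℕ) → ZMod 2) (l : List ι) (S : Finset ι)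
    (x : ι → ℕ) (h : cubeCup f l S x ≠ 0) : ∀ i ∈ l, ∃ u w : ι → ℕ,
      (x ≤ u ∧ ∀ k, u k ≤ x k + if k ∈ S then 1 else 0) ∧
      (x ≤ w ∧ ∀ k, w k ≤ x k + if k ∈ S then 1 else 0) ∧ f i u ≠ f i w := by
  induction l generalizing S x with
  | nil => simp
  | cons a l ih =>
    obtain ⟨j, hj, hne⟩ := Finset.exists_ne_zero_of_sum_ne_zero h
    have hstep : ∀ u : ι → ℕ, (x + Pi.single j 1 ≤ u ∧
        ∀ k, u k ≤ (x + Pi.single j 1 : ι → ℕ) k + if k ∈ S.erase j then 1 else 0) →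
        (x ≤ u ∧ ∀ k, u k ≤ x k + if k ∈ S then 1 else 0) := by
      rintro u ⟨h₁, h₂⟩
      refine ⟨le_trans (fun k => by simp) h₁, fun k => (h₂ k).trans ?_⟩
      rcases eq_or_ne k j with rfl | hk <;> simp [*]
    intro i hi
    rcases List.mem_cons.1 hi with rfl | hi
    · refine ⟨x + Pi.single j 1, x, hstep _ ⟨le_rfl, fun k => by simp⟩, ⟨le_rfl, fun k => by simp⟩,
        fun h => left_ne_zero_of_mul hne ?_⟩
      rw [h, CharTwo.add_self_eq_zero]
    · obtain ⟨u, w, hu, hw, huw⟩ := ih _ _ (right_ne_zero_of_mul hne) i hi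
      exact ⟨u, w, hstep u hu, hstep w hw, huw⟩

variable [Fintype ι]

/-- Base points of the unit cubes with directions `S` in the face of the box `∏ i, [0, t i]` on
which the coordinates outside `S` are maximal. -/
def cubeBase (t : ι → ℕ) (S : Finset ι) : Finset (ι → ℕ) :=
  Fintype.piFinset fun i => if i ∈ S then Finset.range (t i) else {t i}

theorem mem_cubeBase {t : ι → ℕ} {S : Finset ι} {x : ι → ℕ} :
    x ∈ cubeBase t S ↔ (∀ i ∈ S, x i < t i) ∧ ∀ i ∉ S, x i = t i := by
  rw [cubeBase, Fintype.mem_piFinset, ← forall_and]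
  refine forall_congr' fun i => ?_
  by_cases h : i ∈ S <;> simp [h]

/-- Telescoping in the direction `i`. -/
theorem sum_cubeBase_add (t : ι → ℕ) {S : Finset ι} {i : ι} (hi : i ∈ S)
    (ψ : (ι → ℕ) → ZMod 2) :
    ∑ x ∈ cubeBase t S, (ψ (x + Pi.single i 1) + ψ x) =
      ∑ x ∈ cubeBase t (S.erase i), (ψ x + ψ (Function.update x i 0)) := by
  have hbij : ∑ x ∈ cubeBase t S, (ψ (x + Pi.single i 1) + ψ x) =
      ∑ p ∈ cubeBase t (S.erase i) ×ˢ Finset.range (t i),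
        (ψ (Function.update p.1 i (p.2 + 1)) + ψ (Function.update p.1 i p.2)) := by
    refine Finset.sum_nbij' (fun x => (Function.update x i (t i), x i))
      (fun p => Function.update p.1 i p.2) ?_ ?_ ?_ ?_ ?_
    · intro x hx
      rw [mem_cubeBase] at hx
      simp only [Finset.mem_product, mem_cubeBase, Finset.mem_range]
      refine ⟨⟨fun k hk => ?_, fun k hk => ?_⟩, hx.1 i hi⟩
      · rw [Finset.mem_erase] at hk
        simpa [hk.1] using hx.1 k hk.2
      · rcases eq_or_ne k i with rfl | hki
        · simp
        · simpa [hki] using hx.2 k (by simpa [hki] using hk)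
    · rintro ⟨y, k⟩ h
      simp only [Finset.mem_product, mem_cubeBase, Finset.mem_range] at h
      rw [mem_cubeBase]
      refine ⟨fun j hj => ?_, fun j hj => ?_⟩
      · rcases eq_or_ne j i with rfl | hji
        · simpa using h.2
        · simpa [hji] using h.1.1 j (Finset.mem_erase.2 ⟨hji, hj⟩)
      · have hji : j ≠ i := fun h => hj (h ▸ hi)
        simpa [hji] using h.1.2 j (fun h => hj (Finset.mem_of_mem_erase h))
    · intro x _
      simp
    · rintro ⟨y, k⟩ h
      simp only [Finset.mem_product, mem_cubeBase] at h
      simp [← h.1.2 i (by simp)]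
    · intro x _
      have hx : x + Pi.single i 1 = Function.update x i (x i + 1) := by
        ext k
        rcases eq_or_ne k i with rfl | hk <;> simp [*]
      simp [hx]
  rw [hbij, Finset.sum_product]
  refine Finset.sum_congr rfl fun y hy => ?_
  have htel := Finset.sum_range_sub (fun k => ψ (Function.update y i k)) (t i)
  simp only [CharTwo.sub_eq_add] at htel
  rw [htel, ← (mem_cubeBase.1 hy).2 i (by simp), Function.update_eq_self]

theorem sum_cubeCup_eq_one (t : ι → ℕ) (f : ι → (ι → ℕ) → ZMod 2) (l : List ι) (hl : l.Nodup)
    (h0 : ∀ i ∈ l, ∀ x : ι → ℕ, x i = 0 → f i x = 0)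
    (h1 : ∀ i ∈ l, ∀ x : ι → ℕ, x i = t i → f i x = 1) :
    ∑ x ∈ cubeBase t l.toFinset, cubeCup f l l.toFinset x = 1 := by
  induction l with
  | nil => simp [cubeCup, cubeBase, Fintype.piFinset_singleton]
  | cons a l ih =>
    rw [List.nodup_cons] at hl
    set S := (a :: l).toFinset with hS
    have haS : a ∈ S := by simp [hS]
    have hSa : S.erase a = l.toFinset := by
      rw [hS, List.toFinset_cons, Finset.erase_insert (by simpa using hl.1)]
    have hstokes : ∀ x, cubeCup f (a :: l) S x = ∑ i ∈ S,
        (f a (x + Pi.single i 1) * cubeCup f l (S.erase i) (x + Pi.single i 1) +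
          f a x * cubeCup f l (S.erase i) x) := by
      intro x
      simp only [cubeCup, add_mul, Finset.sum_add_distrib]
      simp only [← Finset.mul_sum, cubeCup_closed]
    simp only [hstokes]
    rw [Finset.sum_comm, Finset.sum_eq_single_of_mem a haS]
    · rw [sum_cubeBase_add t haS (fun x => f a x * cubeCup f l (S.erase a) x), hSa,
        ← ih hl.2 (fun i hi => h0 i (List.mem_cons_of_mem _ hi))
          (fun i hi => h1 i (List.mem_cons_of_mem _ hi))]
      refine Finset.sum_congr rfl fun x hx => ?_
      rw [h1 a (by simp) x ((mem_cubeBase.1 hx).2 a (by simpa using hl.1)),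
        h0 a (by simp) _ (Function.update_self ..)]
      simp
    · intro i hi hia
      have hil : i ∈ l := by simpa [hS, hia] using hi
      rw [sum_cubeBase_add t hi (fun x => f a x * cubeCup f l (S.erase i) x)]
      refine Finset.sum_eq_zero fun x hx => ?_
      rw [cubeCup_eq_zero f (h1 i (List.mem_cons_of_mem _ hil)) l hil _ (by simp) x
          ((mem_cubeBase.1 hx).2 i (by simp)),
        cubeCup_eq_zero f (h0 i (List.mem_cons_of_mem _ hil)) l hil _ (by simp) _
          (Function.update_self ..)]
      simp

/-- **Discrete Poincaré–Miranda theorem**: if for each direction `i ∈ S` the two-valued function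
`f i` is `0` on the face `x i = 0` and `1` on the face `x i = t i`, then on some unit cube all these
functions are nonconstant. -/
theorem exists_cube_forall_not_constant (t : ι → ℕ) (f : ι → (ι → ℕ) → ZMod 2) (S : Finset ι)
    (h0 : ∀ i ∈ S, ∀ x : ι → ℕ, x i = 0 → f i x = 0)
    (h1 : ∀ i ∈ S, ∀ x : ι → ℕ, x i = t i → f i x = 1) :
    ∃ x : ι → ℕ, (∀ i ∈ S, x i < t i) ∧ (∀ i ∉ S, x i = t i) ∧ ∀ i ∈ S, ∃ u w : ι → ℕ,
      (x ≤ u ∧ ∀ k, u k ≤ x k + if k ∈ S then 1 else 0) ∧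
      (x ≤ w ∧ ∀ k, w k ≤ x k + if k ∈ S then 1 else 0) ∧ f i u = 0 ∧ f i w = 1 := by
  have hsum := sum_cubeCup_eq_one t f S.toList S.nodup_toList
    (fun i hi => h0 i (by simpa using hi)) (fun i hi => h1 i (by simpa using hi))
  obtain ⟨x, hx, hne⟩ := Finset.exists_ne_zero_of_sum_ne_zero (hsum.trans_ne one_ne_zero)
  rw [Finset.toList_toFinset] at hx hne
  rw [mem_cubeBase] at hx
  refine ⟨x, hx.1, hx.2, fun i hi => ?_⟩
  obtain ⟨u, w, hu, hw, huw⟩ := exists_ne_of_cubeCup_ne_zero f _ S x hne i (by simpa using hi)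
  have key : ∀ a b : ZMod 2, a ≠ b → (a = 0 ∧ b = 1) ∨ (b = 0 ∧ a = 1) := by decide
  rcases key _ _ huw with h | h
  · exact ⟨u, w, hu, hw, h⟩
  · exact ⟨w, u, hw, hu, h⟩

end CubicalCup

/-- The `k`-th grid point. -/
noncomputable def gridPoint (δ : ℝ) (k : ℕ) : ℝ := min ((k : ℝ) * δ) 1

theorem gridPoint_mem_grid (δ : ℝ) (k : ℕ) : gridPoint δ k ∈ grid δ := by
  rcases le_total ((k : ℝ) * δ) 1 with h | h
  · exact Or.inl ⟨k, min_eq_left h, h⟩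
  · exact Or.inr (min_eq_right h)

theorem gridPoint_zero (δ : ℝ) : gridPoint δ 0 = 0 := by simp [gridPoint]

theorem gridPoint_le_one (δ : ℝ) (k : ℕ) : gridPoint δ k ≤ 1 := min_le_right _ _

theorem gridPoint_mono {δ : ℝ} (hδ : 0 ≤ δ) : Monotone (gridPoint δ) := fun _ _ h =>
  min_le_min_right _ (mul_le_mul_of_nonneg_right (Nat.cast_le.2 h) hδ)

theorem gridPoint_nonneg {δ : ℝ} (hδ : 0 ≤ δ) (k : ℕ) : 0 ≤ gridPoint δ k :=
  (gridPoint_zero δ).symm.trans_le (gridPoint_mono hδ k.zero_le)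

theorem abs_gridPoint_sub_le {δ : ℝ} (hδ : 0 ≤ δ) {a b : ℕ} (hab : a ≤ b) (hba : b ≤ a + 1) :
    |gridPoint δ b - gridPoint δ a| ≤ δ := by
  rw [abs_of_nonneg (sub_nonneg.2 (gridPoint_mono hδ hab)), sub_le_iff_le_add]
  refine (gridPoint_mono hδ hba).trans ?_
  rw [gridPoint, gridPoint, ← min_add_add_left]
  refine min_le_min (le_of_eq (by push_cast; ring)) (by linarith)

/-- The largest nondecreasing sequence below `x`. -/
def cutIndex {n : ℕ} (x : Fin (n + 1) → ℕ) (j : Fin (n + 1)) : ℕ :=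
  (Finset.Ici j).inf' Finset.nonempty_Ici x

section CutIndex

variable {n : ℕ} {x y : Fin (n + 1) → ℕ}

theorem cutIndex_le {j k : Fin (n + 1)} (h : j ≤ k) : cutIndex x j ≤ x k :=
  Finset.inf'_le _ (Finset.mem_Ici.2 h)

theorem le_cutIndex {j : Fin (n + 1)} {c : ℕ} (h : ∀ k, j ≤ k → c ≤ x k) : c ≤ cutIndex x j :=
  Finset.le_inf' _ _ fun k hk => h k (Finset.mem_Ici.1 hk)

theorem cutIndex_mono : Monotone (cutIndex x) := fun _ _ h =>
  le_cutIndex fun _ hk => cutIndex_le (h.trans hk)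

theorem cutIndex_le_cutIndex (h : x ≤ y) (j : Fin (n + 1)) : cutIndex x j ≤ cutIndex y j :=
  le_cutIndex fun k hk => (cutIndex_le hk).trans (h k)

theorem cutIndex_le_add_one (h : ∀ k, y k ≤ x k + 1) (j : Fin (n + 1)) :
    cutIndex y j ≤ cutIndex x j + 1 := by
  obtain ⟨k, hk, hxk⟩ := Finset.exists_mem_eq_inf' (Finset.nonempty_Ici (a := j)) x
  rw [cutIndex, cutIndex, hxk]
  exact (Finset.inf'_le _ hk).trans (h k)

theorem cutIndex_last : cutIndex x (Fin.last n) = x (Fin.last n) :=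
  le_antisymm (cutIndex_le le_rfl) (le_cutIndex fun k hk => by rw [Fin.last_le_iff.1 hk])

/-- If `x` attains at `p` an upper bound, the `p`-th piece is empty. -/
theorem cutIndex_castSucc_eq_succ {p : Fin n} (h : x (Fin.last n) ≤ x p.castSucc) :
    cutIndex x p.castSucc = cutIndex x p.succ := by
  refine le_antisymm (cutIndex_mono (Fin.castSucc_lt_succ).le) (le_cutIndex fun k hk => ?_)
  rcases hk.eq_or_lt with rfl | hk
  · exact (cutIndex_le (Fin.le_last _)).trans h
  · exact cutIndex_le (Fin.castSucc_lt_iff_succ_le.1 hk)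

end CutIndex

/-- **Approximate equitability, in terms of indices.** The pieces of a division of `[0,1]` with cut
points on the grid have values within `4 * γ * δ` of the value of the first piece. -/
theorem exists_index_forall_abs_sub_le {n : ℕ} (γ : ℝ) (hγ : 0 ≤ γ)
    (F : Fin (n + 1) → ℝ → ℝ → ℝ)
    (hnorm : ∀ i, ∀ x ∈ Set.Icc (0 : ℝ) 1, F i x x = 0)
    (hnonneg : ∀ i, ∀ ℓ r : ℝ, 0 ≤ ℓ → ℓ ≤ r → r ≤ 1 → 0 ≤ F i ℓ r)
    (hlip : ∀ i, ∀ ℓ r ℓ' r' : ℝ, 0 ≤ ℓ → ℓ ≤ r → r ≤ 1 →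
      0 ≤ ℓ' → ℓ' ≤ r' → r' ≤ 1 →
      |F i ℓ r - F i ℓ' r'| ≤ γ * (|ℓ - ℓ'| + |r - r'|))
    {δ : ℝ} (hδ : 0 ≤ δ) {m : ℕ} (hm : 0 < m) :
    ∃ x : Fin (n + 2) → ℕ, x 0 = 0 ∧ x (Fin.last (n + 1)) = m ∧ ∀ i : Fin (n + 1),
      |F i (gridPoint δ (cutIndex x i.castSucc)) (gridPoint δ (cutIndex x i.succ)) -
        F 0 (gridPoint δ (cutIndex x (0 : Fin (n + 1)).castSucc))
          (gridPoint δ (cutIndex x (0 : Fin (n + 1)).succ))| ≤ 4 * (γ * δ) := by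
  set V : (Fin (n + 2) → ℕ) → Fin (n + 1) → ℝ := fun x i =>
    F i (gridPoint δ (cutIndex x i.castSucc)) (gridPoint δ (cutIndex x i.succ)) with hV
  have hle : ∀ (x : Fin (n + 2) → ℕ) (i : Fin (n + 1)),
      gridPoint δ (cutIndex x i.castSucc) ≤ gridPoint δ (cutIndex x i.succ) := fun x i =>
    gridPoint_mono hδ (cutIndex_mono Fin.castSucc_lt_succ.le)
  have hV0 : ∀ x i, 0 ≤ V x i := fun x i =>
    hnonneg i _ _ (gridPoint_nonneg hδ _) (hle x i) (gridPoint_le_one _ _)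
  have hVempty : ∀ x i, cutIndex x i.castSucc = cutIndex x i.succ → V x i = 0 := fun x i h => by
    simp only [hV, h]
    exact hnorm i _ ⟨gridPoint_nonneg hδ _, gridPoint_le_one _ _⟩
  have hVlip : ∀ x y : Fin (n + 2) → ℕ, x ≤ y → (∀ k, y k ≤ x k + 1) →
      ∀ i, |V y i - V x i| ≤ 2 * (γ * δ) := by
    intro x y hxy hyx i
    refine (hlip i _ _ _ _ (gridPoint_nonneg hδ _) (hle y i) (gridPoint_le_one _ _)
      (gridPoint_nonneg hδ _) (hle x i) (gridPoint_le_one _ _)).trans ?_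
    have hcut : ∀ j, |gridPoint δ (cutIndex y j) - gridPoint δ (cutIndex x j)| ≤ δ := fun j =>
      abs_gridPoint_sub_le hδ (cutIndex_le_cutIndex hxy j) (cutIndex_le_add_one hyx j)
    calc _ ≤ γ * (δ + δ) := by gcongr <;> exact hcut _
      _ = 2 * (γ * δ) := by ring
  let t : Fin (n + 2) → ℕ := fun q => if q = 0 then 0 else m
  let S : Finset (Fin (n + 2)) := Finset.univ.filter fun q => q ≠ 0 ∧ q ≠ Fin.last (n + 1)
  let f : Fin (n + 2) → (Fin (n + 2) → ℕ) → ZMod 2 := fun q x =>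
    if x q = 0 then 0 else if x q = m then 1 else
      if ∃ p : Fin (n + 1), p.castSucc = q ∧ V x p ≤ V x 0 then 1 else 0
  have hS : ∀ {q}, q ∈ S ↔ q ≠ 0 ∧ q ≠ Fin.last (n + 1) := by simp [S]
  obtain ⟨x, -, hxS, hx⟩ := exists_cube_forall_not_constant t f S
    (fun q _ x h => if_pos h) (fun q hq x h => by
      have h' : x q = m := by simpa [t, (hS.1 hq).1] using h
      simp [f, h', hm.ne'])
  have hx0 : x 0 = 0 := by simpa [t] using hxS 0 (by simp [S])
  have hxl : x (Fin.last (n + 1)) = m := by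
    simpa [t, Fin.last_eq_zero_iff] using hxS (Fin.last (n + 1)) (by simp [S])
  refine ⟨x, hx0, hxl, fun i => ?_⟩
  change |V x i - V x 0| ≤ _
  rcases eq_or_ne i 0 with rfl | hi
  · rw [sub_self, abs_zero]
    positivity
  have hiS : i.castSucc ∈ S := hS.2 ⟨by simpa using hi, (Fin.castSucc_lt_last i).ne⟩
  obtain ⟨u, w, ⟨hxu, hux⟩, ⟨hxw, hwx⟩, hfu, hfw⟩ := hx _ hiS
  have hone : ∀ y : Fin (n + 2) → ℕ, (∀ k, y k ≤ x k + if k ∈ S then 1 else 0) →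
      ∀ k, y k ≤ x k + 1 := fun y hy k => (hy k).trans (by split_ifs <;> simp)
  have hu : V u 0 ≤ V u i := by
    by_cases h : u i.castSucc = 0
    · rw [hVempty u 0]
      · exact hV0 u i
      · have hzero : cutIndex u (0 : Fin (n + 1)).succ = 0 := by
          refine Nat.le_zero.1 ((cutIndex_le ?_).trans_eq h)
          rw [Fin.le_def]
          simpa [Nat.one_le_iff_ne_zero] using hi
        exact le_antisymm (cutIndex_mono Fin.castSucc_lt_succ.le) (hzero.trans_le (Nat.zero_le _))
    · by_contra hlt
      simp only [f, if_neg h] at hfu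
      split_ifs at hfu with h₁ h₂
      · exact one_ne_zero hfu
      · exact one_ne_zero hfu
      · exact h₂ ⟨i, rfl, (not_le.1 hlt).le⟩
  have hw : V w i ≤ V w 0 := by
    by_cases h : w i.castSucc = m
    · rw [hVempty w i]
      · exact hV0 w 0
      · refine cutIndex_castSucc_eq_succ ((hwx _).trans ?_)
        simp [S, hxl, h]
    · simp only [f, if_neg h] at hfw
      split_ifs at hfw with h₁ h₂
      · exact absurd hfw zero_ne_one
      · obtain ⟨p, hp, hpV⟩ := h₂
        rwa [Fin.castSucc_injective _ hp] at hpV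
      · exact absurd hfw zero_ne_one
  have hui := abs_le.1 (hVlip x u hxu (hone u hux) i)
  have hu0 := abs_le.1 (hVlip x u hxu (hone u hux) 0)
  have hwi := abs_le.1 (hVlip x w hxw (hone w hwx) i)
  have hw0 := abs_le.1 (hVlip x w hxw (hone w hwx) 0)
  rw [abs_le]
  constructor <;> linarith

/-- **Existence core of the `CakeApxEQ` guarantee.** For nonnegative,
normalized, `γ`-Lipschitz cake valuations `F i` and any `ε ∈ (0, 1/(4γ))`,
there is a contiguous division with all cut points on the grid of
granularity `δ = ε/(8γ)` that is equitable up to an additive `ε`. -/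
theorem stmt_1 (n : ℕ) (hn : 1 ≤ n) (γ : ℝ) (hγ : 0 < γ) (F : Fin n → ℝ → ℝ → ℝ)
    (hnorm : ∀ i, ∀ x ∈ Set.Icc (0 : ℝ) 1, F i x x = 0)
    (hnonneg : ∀ i, ∀ ℓ r : ℝ, 0 ≤ ℓ → ℓ ≤ r → r ≤ 1 → 0 ≤ F i ℓ r)
    (hlip : ∀ i, ∀ ℓ r ℓ' r' : ℝ, 0 ≤ ℓ → ℓ ≤ r → r ≤ 1 →
      0 ≤ ℓ' → ℓ' ≤ r' → r' ≤ 1 →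
      |F i ℓ r - F i ℓ' r'| ≤ γ * (|ℓ - ℓ'| + |r - r'|))
    (ε : ℝ) (hε : 0 < ε) (hε' : ε < 1 / (4 * γ)) :
    ∃ e : ℕ → ℝ, e 0 = 0 ∧ e n = 1 ∧ (∀ i < n, e i ≤ e (i + 1)) ∧
      (∀ i ≤ n, e i ∈ grid (ε / (8 * γ))) ∧
      ∀ i j : Fin n,
        |F i (e i.val) (e (i.val + 1)) - F j (e j.val) (e (j.val + 1))| ≤ ε := by
  obtain ⟨n, rfl⟩ : ∃ k, n = k + 1 := ⟨n - 1, by omega⟩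
  set δ := ε / (8 * γ) with hδ_def
  have hδ : 0 < δ := by positivity
  have hγδ : γ * δ = ε / 8 := by
    rw [hδ_def]
    field_simp
  obtain ⟨m, hm⟩ := exists_nat_gt (1 / δ)
  have hm0 : 0 < m := Nat.cast_pos.1 ((one_div_pos.2 hδ).trans hm)
  obtain ⟨x, hx0, hxl, hx⟩ :=
    exists_index_forall_abs_sub_le γ hγ.le F hnorm hnonneg hlip hδ.le hm0
  have hcast : ∀ i : Fin (n + 1), Fin.ofNat (n + 2) i.val = i.castSucc := fun i =>
    Fin.ext (Nat.mod_eq_of_lt (by omega))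
  have hsucc : ∀ i : Fin (n + 1), Fin.ofNat (n + 2) (i.val + 1) = i.succ := fun i =>
    Fin.ext (Nat.mod_eq_of_lt (by omega))
  refine ⟨fun j => gridPoint δ (cutIndex x (Fin.ofNat (n + 2) j)), ?_, ?_, fun i hi => ?_,
    fun i _ => gridPoint_mem_grid _ _, fun i j => ?_⟩
  · have h0 : cutIndex x (Fin.ofNat (n + 2) 0) = 0 :=
      Nat.le_zero.1 ((cutIndex_le (Fin.zero_le _)).trans_eq hx0)
    simp only [h0, gridPoint_zero]
  · have hlast : Fin.ofNat (n + 2) (n + 1) = Fin.last (n + 1) :=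
      Fin.ext (Nat.mod_eq_of_lt (by omega))
    simp only [hlast, cutIndex_last, hxl]
    exact min_eq_right ((div_lt_iff₀ hδ).1 hm).le
  · have h₁ := hcast ⟨i, hi⟩
    have h₂ := hsucc ⟨i, hi⟩
    simp only at h₁ h₂
    simp only [h₁, h₂]
    exact gridPoint_mono hδ.le (cutIndex_mono Fin.castSucc_lt_succ.le)
  · simp only [hcast, hsucc]
    have hi := abs_le.1 (hx i)
    have hj := abs_le.1 (hx j)
    rw [hγδ] at hi hj
    rw [abs_le]
    constructor <;> linarith
end
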